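/- arXiv:1505.00648 — 3 statements merged into one kernel-verified Lean document; each statement's English description precedes it below -/
import Mathlib

section
/- A hypersemigroup (H, ∘) is regular if and only if for every right ideal A of H and every left ideal B of H, A ∩ B = A*B (equivalently, A ∩ B ⊆ A*B). -/
/-- The product of subsets of a hypergroupoid: `A*B := ⋃_{(a,b) ∈ A×B} a∘b`. -/
def hProd {H : Type*} (circ : H → H → Set H) (A B : Set H) : Set H :=
  ⋃ a ∈ A, ⋃ b ∈ B, circ a b

theorem mem_hProd {H : Type*} {circ : H → H → Set H} {A B : Set H} {p : H} :
    p ∈ hProd circ A B ↔ ∃ a ∈ A, ∃ b ∈ B, p ∈ circ a b := by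
  simp [hProd]

theorem hProd_mono {H : Type*} {circ : H → H → Set H} {A A' B B' : Set H}
    (hA : A ⊆ A') (hB : B ⊆ B') : hProd circ A B ⊆ hProd circ A' B' :=
  Set.biUnion_mono hA fun _ _ => Set.biUnion_mono hB fun _ _ => subset_rfl

theorem exists_mem_circ_assoc {H : Type*} {circ : H → H → Set H}
    (assoc : ∀ x y z : H, hProd circ {x} (circ y z) = hProd circ (circ x y) {z})
    (x y z p : H) : (∃ b ∈ circ y z, p ∈ circ x b) ↔ ∃ c ∈ circ x y, p ∈ circ c z := by
  simpa [mem_hProd] using Set.ext_iff.mp (assoc x y z) p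

theorem hProd_subset_inter {H : Type*} {circ : H → H → Set H} {A B : Set H}
    (hA : hProd circ A Set.univ ⊆ A) (hB : hProd circ Set.univ B ⊆ B) :
    hProd circ A B ⊆ A ∩ B :=
  Set.subset_inter ((hProd_mono subset_rfl (Set.subset_univ _)).trans hA)
    ((hProd_mono (Set.subset_univ _) subset_rfl).trans hB)

theorem inter_subset_hProd_of_regular {H : Type*} {circ : H → H → Set H}
    (hreg : ∀ a : H, ∃ x : H, a ∈ hProd circ (circ a x) {a}) {A B : Set H}
    (hA : hProd circ A Set.univ ⊆ A) : A ∩ B ⊆ hProd circ A B := by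
  rintro a ⟨haA, haB⟩
  obtain ⟨x, hx⟩ := hreg a
  refine hProd_mono (fun y hy => ?_) (Set.singleton_subset_iff.mpr haB) hx
  exact hA (mem_hProd.mpr ⟨a, haA, x, Set.mem_univ x, hy⟩)

/-- The right ideal generated by `a` is a right ideal. -/
theorem hProd_insert_univ_subset {H : Type*} {circ : H → H → Set H}
    (assoc : ∀ x y z : H, hProd circ {x} (circ y z) = hProd circ (circ x y) {z}) (a : H) :
    hProd circ (insert a (⋃ h, circ a h)) Set.univ ⊆ insert a (⋃ h, circ a h) := by
  intro p hp
  obtain ⟨u, hu, k, -, hpk⟩ := mem_hProd.mp hp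
  refine Set.mem_insert_of_mem _ (Set.mem_iUnion.mpr ?_)
  rcases hu with rfl | hu
  · exact ⟨k, hpk⟩
  · obtain ⟨h, hu⟩ := Set.mem_iUnion.mp hu
    obtain ⟨t, -, ht⟩ := (exists_mem_circ_assoc assoc a h k p).mpr ⟨u, hu, hpk⟩
    exact ⟨t, ht⟩

/-- The left ideal generated by `a` is a left ideal. -/
theorem hProd_univ_insert_subset {H : Type*} {circ : H → H → Set H}
    (assoc : ∀ x y z : H, hProd circ {x} (circ y z) = hProd circ (circ x y) {z}) (a : H) :
    hProd circ Set.univ (insert a (⋃ h, circ h a)) ⊆ insert a (⋃ h, circ h a) := by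
  intro p hp
  obtain ⟨k, -, v, hv, hpk⟩ := mem_hProd.mp hp
  refine Set.mem_insert_of_mem _ (Set.mem_iUnion.mpr ?_)
  rcases hv with rfl | hv
  · exact ⟨k, hpk⟩
  · obtain ⟨h, hv⟩ := Set.mem_iUnion.mp hv
    obtain ⟨t, -, ht⟩ := (exists_mem_circ_assoc assoc k h a p).mp ⟨v, hv, hpk⟩
    exact ⟨t, ht⟩

theorem regular_of_inter_subset_hProd {H : Type*} {circ : H → H → Set H}
    (assoc : ∀ x y z : H, hProd circ {x} (circ y z) = hProd circ (circ x y) {z})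
    (hinter : ∀ A B : Set H, A.Nonempty → B.Nonempty →
      hProd circ A Set.univ ⊆ A → hProd circ Set.univ B ⊆ B → A ∩ B ⊆ hProd circ A B)
    (a : H) : ∃ x : H, a ∈ hProd circ (circ a x) {a} := by
  suffices ∃ x, ∃ c ∈ circ a x, a ∈ circ c a by simpa [mem_hProd] using this
  obtain ⟨u, hu, v, hv, hauv⟩ := mem_hProd.mp <|
    hinter _ _ (Set.insert_nonempty _ _) (Set.insert_nonempty _ _)
      (hProd_insert_univ_subset assoc a) (hProd_univ_insert_subset assoc a)
      ⟨Set.mem_insert _ _, Set.mem_insert _ _⟩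
  simp only [Set.mem_insert_iff, Set.mem_iUnion] at hu hv
  rcases hu with rfl | ⟨h, hu⟩ <;> rcases hv with rfl | ⟨k, hv⟩
  · exact ⟨_, _, hauv, hauv⟩
  · exact ⟨k, (exists_mem_circ_assoc assoc _ _ _ _).mp ⟨v, hv, hauv⟩⟩
  · exact ⟨h, u, hu, hauv⟩
  · obtain ⟨w, hw, haw⟩ := (exists_mem_circ_assoc assoc _ _ _ _).mp ⟨v, hv, hauv⟩
    obtain ⟨t, -, ht⟩ := (exists_mem_circ_assoc assoc _ _ _ _).mpr ⟨u, hu, hw⟩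
    exact ⟨t, w, ht, haw⟩

/-- Theorem 16: a hypersemigroup is regular iff `A ∩ B = A*B` (equivalently,
`A ∩ B ⊆ A*B`) for every right ideal `A` and every left ideal `B`. -/
theorem regular_iff_inter_eq_prod {H : Type*} [Nonempty H] (circ : H → H → Set H)
    (hcirc : ∀ a b : H, (circ a b).Nonempty)
    (assoc : ∀ x y z : H, hProd circ {x} (circ y z) = hProd circ (circ x y) {z}) :
    ((∀ a : H, ∃ x : H, a ∈ hProd circ (circ a x) {a}) ↔
      (∀ A B : Set H, A.Nonempty → B.Nonempty →
        hProd circ A Set.univ ⊆ A → hProd circ Set.univ B ⊆ B →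
        A ∩ B = hProd circ A B)) ∧
    ((∀ a : H, ∃ x : H, a ∈ hProd circ (circ a x) {a}) ↔
      (∀ A B : Set H, A.Nonempty → B.Nonempty →
        hProd circ A Set.univ ⊆ A → hProd circ Set.univ B ⊆ B →
        A ∩ B ⊆ hProd circ A B)) := by
  exact ⟨⟨fun hreg _ _ _ _ hA hB =>
      (inter_subset_hProd_of_regular hreg hA).antisymm (hProd_subset_inter hA hB),
    fun h => regular_of_inter_subset_hProd assoc
      fun A B hAne hBne hA hB => (h A B hAne hBne hA hB).subset⟩,
    fun hreg _ _ _ _ hA _ => inter_subset_hProd_of_regular hreg hA,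
    regular_of_inter_subset_hProd assoc⟩
end

section
/- A semigroup (S, ·) is regular if and only if for every right ideal A of S and every left ideal B of S, A ∩ B = AB (equivalently, A ∩ B ⊆ AB). -/
open Pointwise

theorem Set.mul_subset_inter_of_ideals {S : Type*} [Semigroup S] {A B : Set S}
    (hA : A * (Set.univ : Set S) ⊆ A) (hB : (Set.univ : Set S) * B ⊆ B) :
    A * B ⊆ A ∩ B :=
  Set.subset_inter ((Set.mul_subset_mul_left (Set.subset_univ B)).trans hA)
    ((Set.mul_subset_mul_right (Set.subset_univ A)).trans hB)

theorem Set.inter_subset_mul_of_regular {S : Type*} [Semigroup S]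
    (h : ∀ a : S, ∃ x : S, a = a * x * a) {A B : Set S}
    (hA : A * (Set.univ : Set S) ⊆ A) : A ∩ B ⊆ A * B := by
  rintro a ⟨haA, haB⟩
  obtain ⟨x, hx⟩ := h a
  rw [hx]
  exact Set.mul_mem_mul (hA (Set.mul_mem_mul haA (Set.mem_univ x))) haB

/-- Apply the hypothesis to the principal ideals `{a} ∪ aS` and `{a} ∪ Sa`. -/
theorem Semigroup.regular_of_inter_subset_mul {S : Type*} [Semigroup S]
    (h : ∀ A B : Set S, A.Nonempty → B.Nonempty →
      A * (Set.univ : Set S) ⊆ A → (Set.univ : Set S) * B ⊆ B → A ∩ B ⊆ A * B)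
    (a : S) : ∃ x : S, a = a * x * a := by
  have key : a ∈ {u : S | u = a ∨ ∃ s, u = a * s} * {v : S | v = a ∨ ∃ t, v = t * a} := by
    refine h _ _ ⟨a, Or.inl rfl⟩ ⟨a, Or.inl rfl⟩ ?_ ?_ ⟨Or.inl rfl, Or.inl rfl⟩
    · rintro _ ⟨u, rfl | ⟨s, rfl⟩, t, -, rfl⟩
      · exact Or.inr ⟨t, rfl⟩
      · exact Or.inr ⟨s * t, mul_assoc _ _ _⟩
    · rintro _ ⟨s, -, v, rfl | ⟨t, rfl⟩, rfl⟩
      · exact Or.inr ⟨s, rfl⟩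
      · exact Or.inr ⟨s * t, (mul_assoc _ _ _).symm⟩
  obtain ⟨u, hu, v, hv, huv⟩ := key
  change u * v = a at huv
  rcases hu with hu | ⟨s, hu⟩ <;> rcases hv with hv | ⟨t, hv⟩ <;> rw [hu, hv] at huv
  · exact ⟨a, by rw [huv, huv]⟩
  · exact ⟨t, by rw [mul_assoc, huv]⟩
  · exact ⟨s, huv.symm⟩
  · exact ⟨s * t, by rw [← mul_assoc a s t, mul_assoc (a * s) t a, huv]⟩

/-- Iseki's theorem: a semigroup is regular iff `A ∩ B = AB` (equivalently,
`A ∩ B ⊆ AB`) for every right ideal `A` and every left ideal `B`. -/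
theorem semigroup_regular_iff_inter_eq_mul {S : Type*} [Semigroup S] :
    ((∀ a : S, ∃ x : S, a = a * x * a) ↔
      (∀ A B : Set S, A.Nonempty → B.Nonempty →
        A * (Set.univ : Set S) ⊆ A → (Set.univ : Set S) * B ⊆ B →
        A ∩ B = A * B)) ∧
    ((∀ a : S, ∃ x : S, a = a * x * a) ↔
      (∀ A B : Set S, A.Nonempty → B.Nonempty →
        A * (Set.univ : Set S) ⊆ A → (Set.univ : Set S) * B ⊆ B →
        A ∩ B ⊆ A * B)) := by
  refine ⟨⟨fun h A B _ _ hA hB => ?_, fun h => ?_⟩, fun h A B _ _ hA _ => ?_, ?_⟩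
  · exact (Set.inter_subset_mul_of_regular h hA).antisymm (Set.mul_subset_inter_of_ideals hA hB)
  · exact Semigroup.regular_of_inter_subset_mul
      fun A B hA₀ hB₀ hA hB => (h A B hA₀ hB₀ hA hB).subset
  · exact Set.inter_subset_mul_of_regular h hA
  · exact Semigroup.regular_of_inter_subset_mul
end

section
/- A semigroup (S, ·) is intra-regular if and only if for every right ideal A of S and every left ideal B of S, A ∩ B ⊆ BA. -/
open Pointwise

/-- A semigroup is intra-regular iff `A ∩ B ⊆ BA` for every right ideal `A`
and every left ideal `B`. -/
theorem semigroup_intraRegular_iff {S : Type*} [Semigroup S] :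
    (∀ a : S, ∃ x y : S, a = x * a * a * y) ↔
      (∀ A B : Set S, A.Nonempty → B.Nonempty →
        A * (Set.univ : Set S) ⊆ A → (Set.univ : Set S) * B ⊆ B →
        A ∩ B ⊆ B * A) := by
  constructor
  · rintro h A B - - hA hB a ⟨haA, haB⟩
    obtain ⟨x, y, hxy⟩ := h a
    refine Set.mem_mul.2 ⟨x * a, hB (Set.mul_mem_mul (Set.mem_univ x) haB),
      a * y, hA (Set.mul_mem_mul haA (Set.mem_univ y)), ?_⟩
    rw [← mul_assoc, ← hxy]
  · intro h a
    have ha : a ∈ ({a} ∪ {a} * Set.univ : Set S) ∩ ({a} ∪ Set.univ * {a} : Set S) :=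
      ⟨Or.inl rfl, Or.inl rfl⟩
    have hA : ({a} ∪ {a} * Set.univ : Set S) * Set.univ ⊆ {a} ∪ {a} * Set.univ := by
      rw [Set.union_mul, mul_assoc]
      exact Set.union_subset Set.subset_union_right
        ((Set.mul_subset_mul_left (Set.subset_univ _)).trans Set.subset_union_right)
    have hB : Set.univ * ({a} ∪ Set.univ * {a} : Set S) ⊆ {a} ∪ Set.univ * {a} := by
      rw [Set.mul_union, ← mul_assoc]
      exact Set.union_subset Set.subset_union_right
        ((Set.mul_subset_mul_right (Set.subset_univ _)).trans Set.subset_union_right)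
    obtain ⟨b, hb, c, hc, hbc⟩ := Set.mem_mul.1 (h _ _ ⟨a, ha.1⟩ ⟨a, ha.2⟩ hA hB ha)
    rcases hb with rfl | hb <;> rcases hc with rfl | hc
    · exact ⟨c, c, by simp only [hbc]⟩
    · obtain ⟨d, rfl, t, -, rfl⟩ := Set.mem_mul.1 hc
      exact ⟨d, t * t, by simpa only [mul_assoc] using
        (by rw [hbc, hbc] : d = d * (d * (d * t) * t))⟩
    · obtain ⟨s, -, d, rfl, rfl⟩ := Set.mem_mul.1 hb
      exact ⟨s * s, d, by simpa only [mul_assoc] using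
        (by rw [hbc, hbc] : d = s * (s * d * d) * d)⟩
    · obtain ⟨s, -, d, rfl, rfl⟩ := Set.mem_mul.1 hb
      obtain ⟨e, rfl, t, -, rfl⟩ := Set.mem_mul.1 hc
      exact ⟨s, t, by rw [mul_assoc (s * _), hbc]⟩
end
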